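/- arXiv:0906.4309 — 2 statements merged into one kernel-verified Lean document; each statement's English description precedes it below -/
import Mathlib

section
/- (Reducibility criterion) Let P = λ₁φ₁³ + λ₂φ₂³ be a binary cubic over k, where λ₁, λ₂ ∈ k* and φ₁, φ₂ are linear forms with Ω(φ₁,φ₂) ≠ 0, and let q ∈ k* satisfy q² = Q_n(P). Then the following are equivalent: (a) P is reducible over k; (b) λ₁/λ₂ is a cube in k*; (c) q·λ₁ is a cube in k*; (d) q·λ₂ is a cube in k*; (e) there exist linear forms φ₁', φ₂' with Ω(φ₁',φ₂') ≠ 0 such that P = (1/q)(φ₁'³ + φ₂'³). -/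
open MvPolynomial

/-- A binary cubic `a·x³ + 3b·x²y + 3c·xy² + d·y³`, recorded by its coefficients. -/
structure BinCubic (k : Type*) where
  a : k
  b : k
  c : k
  d : k

namespace BinCubic

variable {k : Type*} [Field k]

instance : Zero (BinCubic k) := ⟨⟨0, 0, 0, 0⟩⟩

instance : Add (BinCubic k) :=
  ⟨fun P Q => ⟨P.a + Q.a, P.b + Q.b, P.c + Q.c, P.d + Q.d⟩⟩

instance : Neg (BinCubic k) := ⟨fun P => ⟨-P.a, -P.b, -P.c, -P.d⟩⟩

instance : Sub (BinCubic k) :=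
  ⟨fun P Q => ⟨P.a - Q.a, P.b - Q.b, P.c - Q.c, P.d - Q.d⟩⟩

instance : SMul k (BinCubic k) := ⟨fun t P => ⟨t * P.a, t * P.b, t * P.c, t * P.d⟩⟩

/-- The homogeneous cubic polynomial in `k[x,y]` attached to a binary cubic. -/
noncomputable def toPoly (P : BinCubic k) : MvPolynomial (Fin 2) k :=
  C P.a * X 0 ^ 3 + C (3 * P.b) * X 0 ^ 2 * X 1 +
    C (3 * P.c) * X 0 * X 1 ^ 2 + C P.d * X 1 ^ 3

/-- The linear form `e·x + f·y`. -/
noncomputable def lin (e f : k) : MvPolynomial (Fin 2) k := C e * X 0 + C f * X 1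

/-- A binary quadratic `u·x² + v·xy + w·y²`. -/
noncomputable def quadPoly (u v w : k) : MvPolynomial (Fin 2) k :=
  C u * X 0 ^ 2 + C v * (X 0 * X 1) + C w * X 1 ^ 2

/-- The moment map `μ`. -/
def mu (P : BinCubic k) : Matrix (Fin 2) (Fin 2) k :=
  !![P.a * P.d - P.b * P.c, 2 * (P.b * P.d - P.c ^ 2);
     2 * (P.b ^ 2 - P.a * P.c), -(P.a * P.d - P.b * P.c)]

/-- The normalized quartic invariant `Q_n`. -/
def Qn (P : BinCubic k) : k :=
  P.a ^ 2 * P.d ^ 2 - 3 * P.b ^ 2 * P.c ^ 2 - 6 * P.a * P.b * P.c * P.d +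
    4 * P.b ^ 3 * P.d + 4 * P.a * P.c ^ 3

/-- The derivation action of the trace-free matrix `M = [[α,β],[γ,−α]]` on binary cubics,
induced by `M·x = −αx − βy`, `M·y = −γx + αy`.  Explicitly,
`M·P = (−3aα−3bγ)x³ + (−3aβ−3bα−6cγ)x²y + (−6bβ+3cα−3dγ)xy² + (−3cβ+3dα)y³`. -/
def matAct (M : Matrix (Fin 2) (Fin 2) k) (P : BinCubic k) : BinCubic k :=
  ⟨-(3 * P.a * M 0 0) - 3 * P.b * M 1 0,
   -(P.a * M 0 1) - P.b * M 0 0 - 2 * P.c * M 1 0,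
   -(2 * P.b * M 0 1) + P.c * M 0 0 - P.d * M 1 0,
   -(3 * P.c * M 0 1) + 3 * P.d * M 0 0⟩

/-- The cubic covariant `Ψ(P) = μ(P)·P`. -/
def Psi (P : BinCubic k) : BinCubic k := matAct (mu P) P

/-- The symplectic form `ω` on binary cubics. -/
def omega (P Q : BinCubic k) : k :=
  P.a * Q.d - P.d * Q.a - 3 * P.b * Q.c + 3 * P.c * Q.b

/-- `λ·(ex+fy)³` as a binary cubic. -/
def cubeForm (lam e f : k) : BinCubic k :=
  ⟨lam * e ^ 3, lam * e ^ 2 * f, lam * e * f ^ 2, lam * f ^ 3⟩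

/-- The action on binary cubics of the algebra substitution `x ↦ px + qy`, `y ↦ rx + sy`. -/
def substAct (p q r s : k) (P : BinCubic k) : BinCubic k :=
  ⟨P.a * p ^ 3 + 3 * P.b * p ^ 2 * r + 3 * P.c * p * r ^ 2 + P.d * r ^ 3,
   P.a * p ^ 2 * q + P.b * (p ^ 2 * s + 2 * p * q * r) + P.c * (2 * p * r * s + q * r ^ 2) +
     P.d * r ^ 2 * s,
   P.a * p * q ^ 2 + P.b * (2 * p * q * s + q ^ 2 * r) + P.c * (p * s ^ 2 + 2 * q * r * s) +
     P.d * r * s ^ 2,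
   P.a * q ^ 3 + 3 * P.b * q ^ 2 * s + 3 * P.c * q * s ^ 2 + P.d * s ^ 3⟩

/-- `M^{⊗3}` acting on binary cubics for a trace-free `M = [[α,β],[γ,−α]]`: the algebra
substitution `x ↦ −αx − βy`, `y ↦ −γx + αy`; it sends `φ³` to `(M·φ)³` for linear forms `φ`. -/
def tensorCubeAct (M : Matrix (Fin 2) (Fin 2) k) (P : BinCubic k) : BinCubic k :=
  substAct (-(M 0 0)) (-(M 0 1)) (-(M 1 0)) (M 0 0) P

/-- Action of a trace-free matrix `M = [[α,β],[γ,−α]]` on the linear form `ex + fy`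
(`M·x = −αx − βy`, `M·y = −γx + αy`), recorded by the resulting pair of coefficients. -/
def linAct (M : Matrix (Fin 2) (Fin 2) k) (e f : k) : k × k :=
  (-(e * M 0 0) - f * M 1 0, -(e * M 0 1) + f * M 0 0)

/-- Evaluation of `P` at the point `(u, w) ∈ k²`. -/
def evalAt (P : BinCubic k) (u w : k) : k :=
  P.a * u ^ 3 + 3 * P.b * u ^ 2 * w + 3 * P.c * u * w ^ 2 + P.d * w ^ 3

/-- The symplectic form `Ω` on `k²`. -/
def Omeg (v w : Fin 2 → k) : k := v 0 * w 1 - v 1 * w 0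

/-- The action of `g = [[α,β],[γ,δ]]` on polynomials by the algebra substitution
`g·x = δx − βy`, `g·y = −γx + αy`. -/
noncomputable def slAct (g : Matrix (Fin 2) (Fin 2) k) (P : MvPolynomial (Fin 2) k) :
    MvPolynomial (Fin 2) k :=
  aeval ![C (g 1 1) * X 0 - C (g 0 1) * X 1, C (g 0 0) * X 1 - C (g 1 0) * X 0] P

/-- The symmetric bilinear polarization `B_μ` of the moment map: `B_μ(P,P) = μ(P)`. -/
def Bmu (P Q : BinCubic k) : Matrix (Fin 2) (Fin 2) k :=
  !![(P.a * Q.d + P.d * Q.a - P.b * Q.c - P.c * Q.b) / 2,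
       (P.b * Q.d + P.d * Q.b) - P.c * Q.c;
     P.b * Q.b - (P.a * Q.c + P.c * Q.a),
       -((P.a * Q.d + P.d * Q.a - P.b * Q.c - P.c * Q.b) / 2)]

/-- `P` is reducible over `k`: it factors as (nonzero linear form)·(binary quadratic). -/
def IsReducible (P : BinCubic k) : Prop :=
  ∃ e f u v w : k, (e ≠ 0 ∨ f ≠ 0) ∧ toPoly P = lin e f * quadPoly u v w

end BinCubic

namespace BinCubic

theorem Qn_cubeForm_add_cubeForm {k : Type*} [Field k] (lam1 lam2 e1 f1 e2 f2 : k) :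
    Qn (cubeForm lam1 e1 f1 + cubeForm lam2 e2 f2) =
      (lam1 * lam2 * (e1 * f2 - f1 * e2) ^ 3) ^ 2 := by
  change Qn ⟨_ + _, _ + _, _ + _, _ + _⟩ = _
  simp only [Qn, cubeForm]
  ring

theorem eval_toPoly_cubeForm_add_cubeForm {k : Type*} [Field k]
    (lam1 lam2 e1 f1 e2 f2 x y : k) :
    eval ![x, y] (toPoly (cubeForm lam1 e1 f1 + cubeForm lam2 e2 f2)) =
      lam1 * (e1 * x + f1 * y) ^ 3 + lam2 * (e2 * x + f2 * y) ^ 3 := by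
  change eval ![x, y] (toPoly ⟨_ + _, _ + _, _ + _, _ + _⟩) = _
  simp [toPoly, cubeForm]
  ring

/-- A sum of two cubes of independent linear forms vanishes at a nonzero point only if the
ratio of the coefficients is a cube. -/
theorem IsReducible.exists_div_eq_cube {k : Type*} [Field k] {lam1 lam2 e1 f1 e2 f2 : k}
    (hl1 : lam1 ≠ 0) (hl2 : lam2 ≠ 0) (hphi : e1 * f2 - f1 * e2 ≠ 0)
    (h : IsReducible (cubeForm lam1 e1 f1 + cubeForm lam2 e2 f2)) :
    ∃ r : k, r ≠ 0 ∧ lam1 / lam2 = r ^ 3 := by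
  obtain ⟨e, f, u, v, w, hef, hfac⟩ := h
  have heval := congrArg (eval ![f, -e]) hfac
  rw [eval_toPoly_cubeForm_add_cubeForm] at heval
  have hzero : eval ![f, -e] (lin e f * quadPoly u v w) = 0 := by
    simp only [lin, quadPoly, map_mul, map_add, eval_C, eval_X]
    simp
    left
    ring
  rw [hzero] at heval
  set s := e1 * f + f1 * -e
  set t := e2 * f + f2 * -e
  have hst : ¬(s = 0 ∧ t = 0) := by
    rintro ⟨hs0, ht0⟩
    have he : (e1 * f2 - f1 * e2) * e = 0 := by linear_combination e2 * hs0 - e1 * ht0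
    have hf : (e1 * f2 - f1 * e2) * f = 0 := by linear_combination f2 * hs0 - f1 * ht0
    rcases hef with h | h
    · exact (mul_ne_zero hphi h) he
    · exact (mul_ne_zero hphi h) hf
  have hs0 : s ≠ 0 := by
    intro h
    have : lam2 * t ^ 3 = 0 := by simpa [h] using heval
    exact hst ⟨h, by simpa [hl2] using this⟩
  have ht0 : t ≠ 0 := by
    intro h
    have : lam1 * s ^ 3 = 0 := by simpa [h] using heval
    exact hst ⟨by simpa [hl1] using this, h⟩
  refine ⟨-t / s, div_ne_zero (neg_ne_zero.mpr ht0) hs0, ?_⟩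
  field_simp
  linear_combination heval

theorem isReducible_cubeForm_add_cubeForm {k : Type*} [Field k] (c : k) {e1 f1 e2 f2 : k}
    (hphi : e1 * f2 - f1 * e2 ≠ 0) : IsReducible (cubeForm c e1 f1 + cubeForm c e2 f2) := by
  refine ⟨e1 + e2, f1 + f2, c * (e1 ^ 2 - e1 * e2 + e2 ^ 2),
    c * (2 * e1 * f1 - e1 * f2 - f1 * e2 + 2 * e2 * f2),
    c * (f1 ^ 2 - f1 * f2 + f2 ^ 2), ?_, ?_⟩
  · by_contra! h
    exact hphi (by linear_combination f2 * h.1 - e2 * h.2)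
  · change toPoly ⟨_ + _, _ + _, _ + _, _ + _⟩ = _
    simp only [toPoly, lin, quadPoly, cubeForm, map_mul, map_add, map_sub, map_pow, map_ofNat]
    ring

theorem cubeForm_one_div_mul {k : Type*} [Field k] {q lam r : k} (hq : q ≠ 0)
    (h : q * lam = r ^ 3) (e f : k) : cubeForm (1 / q) (r * e) (r * f) = cubeForm lam e f := by
  have hlam : lam = r ^ 3 / q := by
    field_simp
    linear_combination h
  simp only [cubeForm, hlam, mk.injEq]
  refine ⟨?_, ?_, ?_, ?_⟩ <;> ring

end BinCubic

open BinCubic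
/-- reducibility criterion for `P = λ₁φ₁³ + λ₂φ₂³` with `q² = Q_n(P)`,
`q ≠ 0`: (a) reducible ⟺ (b) `λ₁/λ₂` a cube ⟺ (c) `qλ₁` a cube ⟺ (d) `qλ₂` a cube ⟺
(e) `P = (1/q)(φ₁'³ + φ₂'³)` for some basis `φ₁', φ₂'`. -/
theorem stmt17 {k : Type*} [Field k] (h2 : (2 : k) ≠ 0) (h3 : (3 : k) ≠ 0)
    (P : BinCubic k) (lam1 lam2 e1 f1 e2 f2 q : k)
    (hl1 : lam1 ≠ 0) (hl2 : lam2 ≠ 0) (hphi : e1 * f2 - f1 * e2 ≠ 0)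
    (hP : P = cubeForm lam1 e1 f1 + cubeForm lam2 e2 f2)
    (hq : q ≠ 0) (hQ : q ^ 2 = Qn P) :
    (IsReducible P ↔ ∃ r : k, r ≠ 0 ∧ lam1 / lam2 = r ^ 3) ∧
      (IsReducible P ↔ ∃ r : k, r ≠ 0 ∧ q * lam1 = r ^ 3) ∧
      (IsReducible P ↔ ∃ r : k, r ≠ 0 ∧ q * lam2 = r ^ 3) ∧
      (IsReducible P ↔ ∃ e1' f1' e2' f2' : k, e1' * f2' - f1' * e2' ≠ 0 ∧
        P = cubeForm (1 / q) e1' f1' + cubeForm (1 / q) e2' f2') := by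
  subst hP
  obtain ⟨w, hw, hqw⟩ : ∃ w : k, w ≠ 0 ∧ q = lam1 * lam2 * w ^ 3 := by
    rw [Qn_cubeForm_add_cubeForm] at hQ
    rcases sq_eq_sq_iff_eq_or_eq_neg.mp hQ with h | h
    · exact ⟨_, hphi, h⟩
    · exact ⟨_, neg_ne_zero.mpr hphi, by rw [h]; ring⟩
  have hab := IsReducible.exists_div_eq_cube (e1 := e1) (f1 := f1) (e2 := e2) (f2 := f2)
    hl1 hl2 hphi
  have hbc : (∃ r : k, r ≠ 0 ∧ lam1 / lam2 = r ^ 3) → ∃ r : k, r ≠ 0 ∧ q * lam1 = r ^ 3 := by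
    rintro ⟨r, hr, h⟩
    rw [div_eq_iff hl2] at h
    refine ⟨r ^ 2 * lam2 * w, mul_ne_zero (mul_ne_zero (pow_ne_zero 2 hr) hl2) hw, ?_⟩
    rw [hqw, h]
    ring
  have cube_of_cube : ∀ {l l' : k}, q = l * l' * w ^ 3 →
      (∃ r : k, r ≠ 0 ∧ q * l = r ^ 3) → ∃ r : k, r ≠ 0 ∧ q * l' = r ^ 3 := by
    rintro l l' hq' ⟨r, hr, h⟩
    refine ⟨q / (w * r), div_ne_zero hq (mul_ne_zero hw hr), ?_⟩
    rw [div_pow, eq_div_iff (pow_ne_zero 3 (mul_ne_zero hw hr)), mul_pow, ← h]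
    linear_combination (-q ^ 2) * hq'
  have hcd := cube_of_cube hqw
  have hdc := cube_of_cube (l := lam2) (l' := lam1) (by rw [hqw]; ring)
  have hce : (∃ r : k, r ≠ 0 ∧ q * lam1 = r ^ 3) → ∃ e1' f1' e2' f2' : k,
      e1' * f2' - f1' * e2' ≠ 0 ∧ cubeForm lam1 e1 f1 + cubeForm lam2 e2 f2 =
        cubeForm (1 / q) e1' f1' + cubeForm (1 / q) e2' f2' := by
    intro hc
    obtain ⟨s, hs, h2'⟩ := hcd hc
    obtain ⟨r, hr, h1'⟩ := hc
    refine ⟨r * e1, r * f1, s * e2, s * f2, ?_, ?_⟩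
    · convert mul_ne_zero (mul_ne_zero hr hs) hphi using 1
      ring
    · rw [cubeForm_one_div_mul hq h1', cubeForm_one_div_mul hq h2']
  have hea : (∃ e1' f1' e2' f2' : k,
      e1' * f2' - f1' * e2' ≠ 0 ∧ cubeForm lam1 e1 f1 + cubeForm lam2 e2 f2 =
        cubeForm (1 / q) e1' f1' + cubeForm (1 / q) e2' f2') →
      IsReducible (cubeForm lam1 e1 f1 + cubeForm lam2 e2 f2) := by
    rintro ⟨_, _, _, _, hne, h⟩
    rw [h]
    exact isReducible_cubeForm_add_cubeForm _ hne
  exact ⟨⟨hab, fun h => hea (hce (hbc h))⟩, ⟨fun h => hbc (hab h), fun h => hea (hce h)⟩,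
    ⟨fun h => hcd (hbc (hab h)), fun h => hea (hce (hdc h))⟩,
    ⟨fun h => hce (hbc (hab h)), hea⟩⟩
end

section
/- Let P and P' be binary cubics over k, each reducible over k, with Q_n(P) = Q_n(P') ≠ 0. Then there exists g ∈ SL(2,k) such that g·P = P'. -/
open MvPolynomial

namespace BinCubic

section

variable {k : Type*} [Field k]

/-- Two binary cubics are related if a unimodular linear substitution carries one to the other. -/
def UnimodularEquiv (P P' : BinCubic k) : Prop :=
  ∃ p q r s : k, p * s - q * r = 1 ∧ substAct p q r s P = P'

lemma substAct_substAct (p q r s p' q' r' s' : k) (P : BinCubic k) :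
    substAct p' q' r' s' (substAct p q r s P) =
      substAct (p * p' + q * r') (p * q' + q * s') (r * p' + s * r') (r * q' + s * s') P := by
  simp only [substAct, mk.injEq]
  refine ⟨?_, ?_, ?_, ?_⟩ <;> ring

lemma substAct_one (P : BinCubic k) : substAct 1 0 0 1 P = P := by
  simp [substAct]

lemma Qn_substAct (p q r s : k) (P : BinCubic k) :
    Qn (substAct p q r s P) = (p * s - q * r) ^ 6 * Qn P := by
  simp only [substAct, Qn]
  ring

namespace UnimodularEquiv

lemma symm {P P' : BinCubic k} (h : UnimodularEquiv P P') : UnimodularEquiv P' P := by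
  obtain ⟨p, q, r, s, hdet, rfl⟩ := h
  refine ⟨s, -q, -r, p, by linear_combination hdet, ?_⟩
  have h₁ : p * s + q * -r = 1 := by linear_combination hdet
  have h₂ : p * -q + q * p = 0 := by ring
  have h₃ : r * s + s * -r = 0 := by ring
  have h₄ : r * -q + s * p = 1 := by linear_combination hdet
  rw [substAct_substAct, h₁, h₂, h₃, h₄, substAct_one]

lemma trans {P P' P'' : BinCubic k} (h : UnimodularEquiv P P') (h' : UnimodularEquiv P' P'') :
    UnimodularEquiv P P'' := by
  obtain ⟨p, q, r, s, hdet, rfl⟩ := h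
  obtain ⟨p', q', r', s', hdet', rfl⟩ := h'
  exact ⟨_, _, _, _, by linear_combination (p' * s' - q' * r') * hdet + hdet',
    (substAct_substAct ..).symm⟩

lemma Qn_eq {P P' : BinCubic k} (h : UnimodularEquiv P P') : Qn P' = Qn P := by
  obtain ⟨p, q, r, s, hdet, rfl⟩ := h
  rw [Qn_substAct, hdet, one_pow, one_mul]

lemma exists_slAct {P P' : BinCubic k} (h : UnimodularEquiv P P') :
    ∃ g : Matrix.SpecialLinearGroup (Fin 2) k, slAct (↑g) (toPoly P) = toPoly P' := by
  obtain ⟨p, q, r, s, hdet, rfl⟩ := h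
  refine ⟨⟨!![s, -q; -r, p], by rw [Matrix.det_fin_two_of]; linear_combination hdet⟩, ?_⟩
  have hC2 : (C 2 : MvPolynomial (Fin 2) k) = 2 := map_ofNat C 2
  have hC3 : (C 3 : MvPolynomial (Fin 2) k) = 3 := map_ofNat C 3
  simp [slAct, toPoly, substAct, algebraMap_eq]
  rw [hC2, hC3]
  ring

end UnimodularEquiv

lemma IsReducible.exists_evalAt_eq_zero {P : BinCubic k} (h : IsReducible P) :
    ∃ x y : k, (x ≠ 0 ∨ y ≠ 0) ∧ evalAt P x y = 0 := by
  obtain ⟨e, f, u, v, w, hef, hP⟩ := h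
  refine ⟨f, -e, hef.symm.imp_right neg_ne_zero.mpr, ?_⟩
  have := congrArg (MvPolynomial.eval ![f, -e]) hP
  simp [toPoly, lin, quadPoly] at this
  simp only [evalAt]
  linear_combination this

lemma exists_unimodularEquiv_a_eq_zero {P : BinCubic k} {x y : k} (hxy : x ≠ 0 ∨ y ≠ 0)
    (h : evalAt P x y = 0) : ∃ P' : BinCubic k, UnimodularEquiv P P' ∧ P'.a = 0 := by
  obtain ⟨q, s, hdet⟩ : ∃ q s : k, x * s - q * y = 1 := by
    rcases hxy with hx | hy
    · exact ⟨0, x⁻¹, by simp [hx]⟩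
    · exact ⟨-y⁻¹, 0, by simp [hy]⟩
  exact ⟨_, ⟨x, q, y, s, hdet, rfl⟩, h⟩

lemma unimodularEquiv_normalForm_of_a_eq_zero (h2 : (2 : k) ≠ 0) {P : BinCubic k}
    (ha : P.a = 0) (hQ : Qn P ≠ 0) : UnimodularEquiv P ⟨0, 1, 0, Qn P / 4⟩ := by
  have hb : P.b ≠ 0 := by
    intro hb
    simp [Qn, ha, hb] at hQ
  have h4 : (4 : k) ≠ 0 := by
    have := mul_ne_zero h2 h2
    norm_num at this
    exact this
  refine ⟨P.b⁻¹, -P.c / 2, 0, P.b, by simp [hb], ?_⟩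
  simp only [substAct, Qn, ha, mk.injEq]
  refine ⟨by ring, by field_simp; ring, by field_simp; ring, ?_⟩
  field_simp
  ring

/-- Every reducible cubic of nonzero discriminant is equivalent to `3x²y + (Qₙ(P)/4)y³`. -/
lemma IsReducible.unimodularEquiv_normalForm (h2 : (2 : k) ≠ 0) {P : BinCubic k}
    (h : IsReducible P) (hQ : Qn P ≠ 0) : UnimodularEquiv P ⟨0, 1, 0, Qn P / 4⟩ := by
  obtain ⟨x, y, hxy, h0⟩ := h.exists_evalAt_eq_zero
  obtain ⟨P', hPP', ha⟩ := exists_unimodularEquiv_a_eq_zero hxy h0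
  rw [← hPP'.Qn_eq] at hQ ⊢
  exact hPP'.trans (unimodularEquiv_normalForm_of_a_eq_zero h2 ha hQ)

end

end BinCubic

open BinCubic
/-- two reducible binary cubics with the same nonzero discriminant are in
the same `SL(2,k)`-orbit. -/
theorem stmt18 {k : Type*} [Field k] (h2 : (2 : k) ≠ 0) (h3 : (3 : k) ≠ 0)
    (P P' : BinCubic k) (hred : IsReducible P) (hred' : IsReducible P')
    (hQ : Qn P = Qn P') (hQ0 : Qn P ≠ 0) :
    ∃ g : Matrix.SpecialLinearGroup (Fin 2) k,
      slAct (↑g) (toPoly P) = toPoly P' := by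
  have hP := hred.unimodularEquiv_normalForm h2 hQ0
  have hP' := hred'.unimodularEquiv_normalForm h2 (hQ ▸ hQ0)
  rw [← hQ] at hP'
  exact (hP.trans hP'.symm).exists_slAct
end
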